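/- Let K be a field, q a nonzero element of K, and m ≤ n positive integers. Let I₁,…,I_s ∈ Π_{m,n}. Then in O_q(G_{m,n}(K)) the product [I₁]⋯[I_s] can be expressed as a K-linear combination of standard monomials [J₁]⋯[J_s] (with J₁ ≤st ⋯ ≤st J_s) such that in each term J₁ ≤st I₁. -/

import Mathlib

/-- The defining relations of the algebra of quantum `m × n` matrices, with parameter the
unit `u`, imposed on the free algebra on the generators `X (i,j)`. -/
inductive qMatrixRel (R : Type*) [CommRing R] (u : Rˣ) (m n : ℕ) :
    FreeAlgebra R (Fin m × Fin n) → FreeAlgebra R (Fin m × Fin n) → Prop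
  | row : ∀ (i : Fin m) (j l : Fin n), j < l →
      qMatrixRel R u m n (FreeAlgebra.ι R (i, j) * FreeAlgebra.ι R (i, l))
        ((u : R) • (FreeAlgebra.ι R (i, l) * FreeAlgebra.ι R (i, j)))
  | col : ∀ (i k : Fin m) (j : Fin n), i < k →
      qMatrixRel R u m n (FreeAlgebra.ι R (i, j) * FreeAlgebra.ι R (k, j))
        ((u : R) • (FreeAlgebra.ι R (k, j) * FreeAlgebra.ι R (i, j)))
  | antidiag : ∀ (i k : Fin m) (j l : Fin n), k < i → j < l →
      qMatrixRel R u m n (FreeAlgebra.ι R (i, j) * FreeAlgebra.ι R (k, l))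
        (FreeAlgebra.ι R (k, l) * FreeAlgebra.ι R (i, j))
  | diag : ∀ (i k : Fin m) (j l : Fin n), i < k → j < l →
      qMatrixRel R u m n (FreeAlgebra.ι R (i, j) * FreeAlgebra.ι R (k, l))
        (FreeAlgebra.ι R (k, l) * FreeAlgebra.ι R (i, j) +
          ((u : R) - ((u⁻¹ : Rˣ) : R)) • (FreeAlgebra.ι R (i, l) * FreeAlgebra.ι R (k, j)))

/-- The algebra `O_u(M_{m,n}(R))` of quantum `m × n` matrices over `R`. -/
abbrev QuantumMat (R : Type*) [CommRing R] (u : Rˣ) (m n : ℕ) :=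
  RingQuot (qMatrixRel R u m n)

/-- The generator `X i j` of the algebra of quantum matrices. -/
def qX (R : Type*) [CommRing R] (u : Rˣ) {m n : ℕ} (i : Fin m) (j : Fin n) :
    QuantumMat R u m n :=
  RingQuot.mkAlgHom R (qMatrixRel R u m n) (FreeAlgebra.ι R (i, j))

/-- The number of inversions (i.e. the Coxeter length) of a permutation of `Fin t`. -/
def permLength {t : ℕ} (σ : Equiv.Perm (Fin t)) : ℕ :=
  (Finset.univ.filter fun p : Fin t × Fin t => p.1 < p.2 ∧ σ p.2 < σ p.1).card

/-- The index set `Π_{m,n}` of maximal quantum minors consists of the `m`-element subsets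
`{j₁ < ⋯ < j_m} ⊆ {1,…,n}`, encoded as order embeddings `Fin m ↪o Fin n`; it carries the
standard partial order `I ≤st J ↔ ∀ s, i_s ≤ j_s` (pointwise order). -/
instance piPartialOrder (m n : ℕ) : PartialOrder (Fin m ↪o Fin n) :=
  PartialOrder.lift (fun f => (f : Fin m → Fin n)) DFunLike.coe_injective

instance piFinite (m n : ℕ) : Finite (Fin m ↪o Fin n) :=
  Finite.of_injective (fun f => (f : Fin m → Fin n)) DFunLike.coe_injective

/-- The maximal quantum minor `[J] = Σ_{σ ∈ S_m} (−u)^{ℓ(σ)} X_{1 j_{σ(1)}} ⋯ X_{m j_{σ(m)}}`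
of the generic matrix, for a column index set `J ∈ Π_{m,n}`. -/
def qMaximalMinor (R : Type*) [CommRing R] (u : Rˣ) {m n : ℕ} (J : Fin m ↪o Fin n) :
    QuantumMat R u m n :=
  ∑ σ : Equiv.Perm (Fin m),
    ((-(u : R)) ^ permLength σ) • (List.ofFn fun i : Fin m => qX R u i (J (σ i))).prod

section
variable {R A α β : Type*} [CommRing R] [Ring A] [Algebra R A]

/-- Iterated Laplace expansion. For a list `l` of row indices and a finite set `C` of column
indices, this is the sum over the bijections `f : l → C` of
`c ^ inv(f) • ∏ X a (f a)`, the product being taken in the order of the list `l`. -/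
def laplaceSum [LinearOrder β] (c : R) (X : α → β → A) : List α → Finset β → A
  | [], C => if C = ∅ then 1 else 0
  | a :: l, C =>
    ∑ b ∈ C, c ^ (C.filter (· < b)).card • (X a b * laplaceSum c X l (C.erase b))

/-- A family `X` in an algebra satisfies the relations of a quantum matrix with parameter `u`. -/
structure IsQuantumMatrix [LinearOrder α] [LinearOrder β] (u : Rˣ) (X : α → β → A) : Prop where
  row : ∀ {i : α} {j l : β}, j < l → X i j * X i l = (u : R) • (X i l * X i j)
  col : ∀ {i k : α} {j : β}, i < k → X i j * X k j = (u : R) • (X k j * X i j)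
  antidiag : ∀ {i k : α} {j l : β}, k < i → j < l → X i j * X k l = X k l * X i j
  diag : ∀ {i k : α} {j l : β}, i < k → j < l →
    X i j * X k l = X k l * X i j + ((u : R) - ((u⁻¹ : Rˣ) : R)) • (X i l * X k j)

theorem IsQuantumMatrix.transpose [LinearOrder α] [LinearOrder β] {u : Rˣ} {X : α → β → A}
    (h : IsQuantumMatrix u X) : IsQuantumMatrix u (fun b a => X a b) where
  row := h.col
  col := h.row
  antidiag hk hj := (h.antidiag hj hk).symm
  diag {i k j l} hi hj := by rw [h.diag hj hi, h.antidiag hj hi]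

section Laplace
variable [LinearOrder β] (c : R) (X : α → β → A)

theorem laplaceSum_nil (C : Finset β) : laplaceSum c X [] C = if C = ∅ then 1 else 0 := rfl

theorem laplaceSum_cons (a : α) (l : List α) (C : Finset β) :
    laplaceSum c X (a :: l) C =
      ∑ b ∈ C, c ^ (C.filter (· < b)).card • (X a b * laplaceSum c X l (C.erase b)) := rfl

theorem laplaceSum_eq_zero_of_length_ne {l : List α} {C : Finset β} (h : l.length ≠ C.card) :
    laplaceSum c X l C = 0 := by
  induction l generalizing C with
  | nil =>
    rw [laplaceSum_nil, if_neg]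
    rintro rfl
    simp at h
  | cons a l ih =>
    rw [laplaceSum_cons]
    refine Finset.sum_eq_zero fun b hb => ?_
    have hc := Finset.card_erase_add_one hb
    rw [ih (by simp only [List.length_cons] at h; omega), mul_zero, smul_zero]

theorem card_filter_lt_erase_add_one {C : Finset β} {b b' : β} (hb : b ∈ C) (h : b < b') :
    ((C.erase b).filter (· < b')).card + 1 = (C.filter (· < b')).card := by
  rw [Finset.filter_erase, Finset.card_erase_add_one (by simp [hb, h])]

theorem card_filter_lt_erase_of_le {C : Finset β} {b b' : β} (h : b ≤ b') :
    ((C.erase b').filter (· < b)).card = (C.filter (· < b)).card := by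
  rw [Finset.filter_erase, Finset.erase_eq_of_notMem (by simp [h])]

/-- Expansion along two rows, grouped by pairs of columns. -/
theorem laplaceSum_cons_cons (a a' : α) (l : List α) (C : Finset β) :
    laplaceSum c X (a :: a' :: l) C = ∑ b ∈ C, ∑ b' ∈ C, if b < b' then
      c ^ ((C.filter (· < b)).card + ((C.erase b).filter (· < b')).card) •
        ((X a b * X a' b' + c • (X a b' * X a' b)) * laplaceSum c X l ((C.erase b).erase b'))
      else 0 := by
  let f : β → β → A := fun b b' =>
    c ^ ((C.filter (· < b)).card + ((C.erase b).filter (· < b')).card) •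
      (X a b * X a' b' * laplaceSum c X l ((C.erase b).erase b'))
  have h₁ : laplaceSum c X (a :: a' :: l) C = ∑ b ∈ C, ∑ b' ∈ C.erase b, f b b' := by
    rw [laplaceSum_cons]
    refine Finset.sum_congr rfl fun b _ => ?_
    rw [laplaceSum_cons, Finset.mul_sum, Finset.smul_sum]
    refine Finset.sum_congr rfl fun b' _ => ?_
    rw [mul_smul_comm, smul_smul, ← pow_add, ← mul_assoc]
  have h₂ : ∀ b ∈ C, ∑ b' ∈ C.erase b, f b b' =
      (∑ b' ∈ C, if b < b' then f b b' else 0) + ∑ b' ∈ C, if b' < b then f b b' else 0 := by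
    intro b hb
    rw [← Finset.sum_add_distrib, ← Finset.add_sum_erase C _ hb]
    simp only [lt_irrefl, if_false, zero_add]
    refine Finset.sum_congr rfl fun b' hb' => ?_
    rcases lt_or_gt_of_ne (Finset.ne_of_mem_erase hb') with h | h
    · rw [if_neg h.not_gt, if_pos h, zero_add]
    · rw [if_neg h.not_gt, if_pos h, add_zero]
  rw [h₁, Finset.sum_congr rfl h₂, Finset.sum_add_distrib,
    Finset.sum_comm (f := fun b b' => if b' < b then f b b' else 0), ← Finset.sum_add_distrib]
  refine Finset.sum_congr rfl fun b hb => ?_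
  rw [← Finset.sum_add_distrib]
  refine Finset.sum_congr rfl fun b' hb' => ?_
  split_ifs with h
  · have e₁ := card_filter_lt_erase_add_one hb h
    have e₂ := card_filter_lt_erase_of_le (C := C) h.le
    simp only [f]
    rw [e₂, ← e₁, Finset.erase_right_comm (a := b') (b := b), add_mul, smul_add, smul_mul_assoc,
      smul_smul, ← pow_succ]
    congr 3
    ring
  · rw [add_zero]

theorem laplaceSum_cons_congr {l l' : List α} {v : Rˣ}
    (h : ∀ C, laplaceSum c X l C = v • laplaceSum c X l' C) (a : α) (C : Finset β) :
    laplaceSum c X (a :: l) C = v • laplaceSum c X (a :: l') C := by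
  rw [laplaceSum_cons, laplaceSum_cons, Finset.smul_sum]
  refine Finset.sum_congr rfl fun b _ => ?_
  rw [h, mul_smul_comm, smul_comm]

/-- Laplace expansion along several rows. -/
theorem laplaceSum_append (l l' : List α) (C : Finset β) :
    laplaceSum c X (l ++ l') C = ∑ B ∈ C.powerset,
      c ^ (∑ b ∈ B, ((C \ B).filter (· < b)).card) •
        (laplaceSum c X l B * laplaceSum c X l' (C \ B)) := by
  induction l generalizing C with
  | nil =>
    rw [Finset.sum_eq_single ∅]
    · simp [laplaceSum_nil]
    · intro B _ hB
      rw [laplaceSum_nil, if_neg hB, zero_mul, smul_zero]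
    · simp
  | cons a l ih =>
    rw [List.cons_append, laplaceSum_cons]
    simp only [ih, laplaceSum_cons, Finset.mul_sum, Finset.sum_mul, Finset.smul_sum,
      mul_smul_comm, smul_mul_assoc, smul_smul, ← pow_add, mul_assoc]
    rw [Finset.sum_sigma', Finset.sum_sigma']
    refine Finset.sum_bij' (fun p _ => ⟨insert p.1 p.2, p.1⟩) (fun p _ => ⟨p.2, p.1.erase p.2⟩)
      ?_ ?_ ?_ ?_ ?_
    · rintro ⟨b, B⟩ h
      simp only [Finset.mem_sigma, Finset.mem_powerset] at h ⊢
      exact ⟨Finset.insert_subset h.1 (h.2.trans (Finset.erase_subset _ _)),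
        Finset.mem_insert_self _ _⟩
    · rintro ⟨B, b⟩ h
      simp only [Finset.mem_sigma, Finset.mem_powerset] at h ⊢
      exact ⟨h.1 h.2, Finset.erase_subset_erase _ h.1⟩
    · rintro ⟨b, B⟩ h
      simp only [Finset.mem_sigma, Finset.mem_powerset] at h
      have hb : b ∉ B := fun hb => Finset.notMem_erase b C (h.2 hb)
      simp [Finset.erase_insert hb]
    · rintro ⟨B, b⟩ h
      simp only [Finset.mem_sigma, Finset.mem_powerset] at h
      simp [Finset.insert_erase h.2]
    · rintro ⟨b, B⟩ h
      simp only [Finset.mem_sigma, Finset.mem_powerset] at h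
      have hb : b ∉ B := fun hb => Finset.notMem_erase b C (h.2 hb)
      have hBC : insert b B ⊆ C :=
        Finset.insert_subset h.1 (h.2.trans (Finset.erase_subset _ _))
      have e₁ : C.erase b \ B = C \ insert b B := by
        ext x; simp only [Finset.mem_sdiff, Finset.mem_erase, Finset.mem_insert]; tauto
      have e₂ : (C.filter (· < b)).card =
          ((C \ insert b B).filter (· < b)).card + ((insert b B).filter (· < b)).card := by
        rw [← Finset.card_union_of_disjoint
          (Finset.disjoint_filter_filter Finset.sdiff_disjoint), ← Finset.filter_union,
          Finset.sdiff_union_of_subset hBC]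
      simp only [e₁, Finset.erase_insert hb, Finset.sum_insert hb, e₂]
      congr 2
      ring

theorem sort_eq_cons_erase {T : Finset β} {x : β} (hx : x ∈ T) (hmin : ∀ y ∈ T, x ≤ y) :
    T.sort = x :: (T.erase x).sort := by
  conv_lhs => rw [← Finset.insert_erase hx]
  exact Finset.sort_insert _ (fun y hy => hmin y (Finset.mem_of_mem_erase hy))
    (Finset.notMem_erase x T)

/-- Expansion along the first row, with the column of the first entry treated separately. -/
theorem laplaceSum_cons_of_forall_le (a : α) (l : List α) {C : Finset β} {b : β} (hb : b ∈ C)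
    (hmin : ∀ y ∈ C, b ≤ y) :
    laplaceSum c X (a :: l) C = X a b * laplaceSum c X l (C.erase b) +
      ∑ x ∈ C.erase b, c ^ (((C.erase b).filter (· < x)).card + 1) •
        (X a x * laplaceSum c X l (C.erase x)) := by
  rw [laplaceSum_cons, ← Finset.add_sum_erase C _ hb]
  congr 1
  · rw [Finset.filter_false_of_mem fun y hy => (hmin y hy).not_gt, Finset.card_empty, pow_zero,
      one_smul]
  · refine Finset.sum_congr rfl fun x hx => ?_
    rw [card_filter_lt_erase_add_one hb]
    exact lt_of_le_of_ne (hmin x (Finset.mem_of_mem_erase hx)) (Finset.ne_of_mem_erase hx).symm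

/-- Expansion along the first row agrees with expansion along the first column. -/
theorem laplaceSum_transpose [LinearOrder α] {X : α → β → A}
    (hX : ∀ {i k : α} {j l : β}, k < i → j < l → X i j * X k l = X k l * X i j)
    (S : Finset α) (C : Finset β) :
    laplaceSum c X S.sort C = laplaceSum c (fun b a => X a b) C.sort S := by
  induction h : S.card using Nat.strong_induction_on generalizing S C with
  | _ t ih =>
  subst h
  rcases S.eq_empty_or_nonempty with rfl | hS
  · rw [Finset.sort_empty, laplaceSum_nil]
    split_ifs with hC
    · simp [hC, laplaceSum_nil]
    · rw [laplaceSum_eq_zero_of_length_ne]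
      simpa using hC
  rcases C.eq_empty_or_nonempty with rfl | hC
  · rw [Finset.sort_empty, laplaceSum_nil, if_neg hS.ne_empty, laplaceSum_eq_zero_of_length_ne]
    simpa using hS.ne_empty
  obtain ⟨s, hs, hsmin⟩ : ∃ s ∈ S, ∀ y ∈ S, s ≤ y :=
    ⟨S.min' hS, S.min'_mem hS, fun y hy => S.min'_le y hy⟩
  obtain ⟨b, hb, hbmin⟩ : ∃ b ∈ C, ∀ y ∈ C, b ≤ y :=
    ⟨C.min' hC, C.min'_mem hC, fun y hy => C.min'_le y hy⟩
  have hlt := Finset.card_erase_lt_of_mem hs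
  rw [sort_eq_cons_erase hs hsmin, sort_eq_cons_erase hb hbmin,
    laplaceSum_cons_of_forall_le c X _ _ hb hbmin,
    laplaceSum_cons_of_forall_le c _ _ _ hs hsmin, ih _ hlt _ _ rfl]
  congr 1
  have e₁ : ∀ x ∈ C.erase b, laplaceSum c X (S.erase s).sort (C.erase x) =
      ∑ y ∈ S.erase s, c ^ ((S.erase s).filter (· < y)).card •
        (X y b * laplaceSum c (fun b a => X a b) ((C.erase b).erase x).sort
          ((S.erase s).erase y)) := by
    intro x hx
    rw [ih _ hlt _ _ rfl, sort_eq_cons_erase (T := C.erase x) (x := b)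
      (Finset.mem_erase.2 ⟨(Finset.ne_of_mem_erase hx).symm, hb⟩)
      (fun y hy => hbmin y (Finset.mem_of_mem_erase hy)), laplaceSum_cons,
      Finset.erase_right_comm]
  have e₂ : ∀ y ∈ S.erase s, laplaceSum c (fun b a => X a b) (C.erase b).sort (S.erase y) =
      ∑ x ∈ C.erase b, c ^ ((C.erase b).filter (· < x)).card •
        (X s x * laplaceSum c (fun b a => X a b) ((C.erase b).erase x).sort
          ((S.erase s).erase y)) := by
    intro y hy
    have hlt' := Finset.card_erase_lt_of_mem hy
    rw [← ih _ (Finset.card_erase_lt_of_mem (Finset.mem_of_mem_erase hy)) _ _ rfl,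
      sort_eq_cons_erase (T := S.erase y) (x := s)
      (Finset.mem_erase.2 ⟨(Finset.ne_of_mem_erase hy).symm, hs⟩)
      (fun x hx => hsmin x (Finset.mem_of_mem_erase hx)), laplaceSum_cons,
      Finset.erase_right_comm]
    refine Finset.sum_congr rfl fun x _ => ?_
    rw [ih _ (hlt'.trans hlt) _ _ rfl]
  calc _ = ∑ x ∈ C.erase b, ∑ y ∈ S.erase s,
        c ^ (((C.erase b).filter (· < x)).card + ((S.erase s).filter (· < y)).card + 1) •
          (X s x * X y b * laplaceSum c (fun b a => X a b) ((C.erase b).erase x).sort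
            ((S.erase s).erase y)) := by
        refine Finset.sum_congr rfl fun x hx => ?_
        rw [e₁ x hx, Finset.mul_sum, Finset.smul_sum]
        refine Finset.sum_congr rfl fun y _ => ?_
        rw [mul_smul_comm, smul_smul, ← pow_add, mul_assoc]
        congr 2
        ring
    _ = _ := by
        rw [Finset.sum_comm]
        refine Finset.sum_congr rfl fun y hy => ?_
        rw [e₂ y hy, Finset.mul_sum, Finset.smul_sum]
        refine Finset.sum_congr rfl fun x hx => ?_
        have hsy : s < y :=
          lt_of_le_of_ne (hsmin y (Finset.mem_of_mem_erase hy)) (Finset.ne_of_mem_erase hy).symm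
        have hbx : b < x :=
          lt_of_le_of_ne (hbmin x (Finset.mem_of_mem_erase hx)) (Finset.ne_of_mem_erase hx).symm
        rw [mul_smul_comm, smul_smul, ← pow_add, ← hX hsy hbx, mul_assoc]
        congr 2
        ring

end Laplace

namespace IsQuantumMatrix
variable [LinearOrder α] [LinearOrder β] {u : Rˣ} {X : α → β → A}

theorem laplaceSum_cons_cons_self (h : IsQuantumMatrix u X) (a : α) (l : List α)
    (C : Finset β) : laplaceSum (-(u : R)) X (a :: a :: l) C = 0 := by
  rw [laplaceSum_cons_cons]
  refine Finset.sum_eq_zero fun b _ => Finset.sum_eq_zero fun b' _ => ?_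
  split_ifs with hb
  · rw [h.row hb, neg_smul, add_neg_cancel, zero_mul, smul_zero]
  · rfl

theorem laplaceSum_cons_cons_swap (h : IsQuantumMatrix u X) {a a' : α} (ha : a < a')
    (l : List α) (C : Finset β) :
    laplaceSum (-(u : R)) X (a' :: a :: l) C =
      (-u) • laplaceSum (-(u : R)) X (a :: a' :: l) C := by
  rw [laplaceSum_cons_cons, laplaceSum_cons_cons, Finset.smul_sum]
  refine Finset.sum_congr rfl fun b _ => ?_
  rw [Finset.smul_sum]
  refine Finset.sum_congr rfl fun b' _ => ?_
  split_ifs with hb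
  · have key : X a' b * X a b' + (-(u : R)) • (X a' b' * X a b) =
        (-u) • (X a b * X a' b' + (-(u : R)) • (X a b' * X a' b)) := by
      rw [h.diag ha hb, h.antidiag ha hb, Units.smul_def, Units.val_neg]
      simp only [smul_add, smul_smul, sub_smul, smul_sub, neg_smul, smul_neg, neg_mul, Units.mul_inv,
        one_smul]
      abel
    rw [key, smul_mul_assoc, smul_comm]
  · rw [smul_zero]

theorem exists_laplaceSum_eq_smul_of_perm (h : IsQuantumMatrix u X) {l l' : List α}
    (hl : l.Perm l') :
    ∃ v : Rˣ, ∀ C, laplaceSum (-(u : R)) X l C = v • laplaceSum (-(u : R)) X l' C := by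
  induction hl with
  | nil => exact ⟨1, fun C => (one_smul _ _).symm⟩
  | cons a _ ih =>
    obtain ⟨v, hv⟩ := ih
    exact ⟨v, laplaceSum_cons_congr _ X hv a⟩
  | swap a a' l =>
    rcases lt_trichotomy a a' with ha | rfl | ha
    · exact ⟨-u, h.laplaceSum_cons_cons_swap ha l⟩
    · exact ⟨1, fun C => (one_smul _ _).symm⟩
    · refine ⟨(-u)⁻¹, fun C => ?_⟩
      rw [h.laplaceSum_cons_cons_swap ha l, inv_smul_smul]
  | trans _ _ ih₁ ih₂ =>
    obtain ⟨v, hv⟩ := ih₁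
    obtain ⟨w, hw⟩ := ih₂
    exact ⟨v * w, fun C => by rw [hv, hw, smul_smul]⟩

theorem laplaceSum_eq_zero_of_not_nodup (h : IsQuantumMatrix u X) {l : List α}
    (hl : ¬ l.Nodup) (C : Finset β) : laplaceSum (-(u : R)) X l C = 0 := by
  induction l generalizing C with
  | nil => simp at hl
  | cons a l ih =>
    by_cases ha : a ∈ l
    · obtain ⟨v, hv⟩ := h.exists_laplaceSum_eq_smul_of_perm ((List.perm_cons_erase ha).cons a)
      rw [hv, h.laplaceSum_cons_cons_self, smul_zero]
    · rw [laplaceSum_cons]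
      refine Finset.sum_eq_zero fun b _ => ?_
      rw [ih fun hnd => hl (List.nodup_cons.2 ⟨ha, hnd⟩), mul_zero, smul_zero]

/-- The quantum Garnir relations between products of two maximal minors, written as column
expansions over the rows in `S` and `T`. -/
theorem sum_laplaceSum_mul_laplaceSum_eq_zero [Fintype α] (h : IsQuantumMatrix u X)
    (S T : Finset α) (P Q : List β) (C : Finset β) (hC : Fintype.card α < C.card) :
    ∑ B ∈ C.powerset, (-(u : R)) ^ (∑ b ∈ B, ((C \ B).filter (· < b)).card) •
      (laplaceSum (-(u : R)) (fun b a => X a b) (P ++ B.sort) S *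
        laplaceSum (-(u : R)) (fun b a => X a b) ((C \ B).sort ++ Q) T) = 0 := by
  have key : ∀ S' T' : Finset α, ∑ B ∈ C.powerset,
      (-(u : R)) ^ (∑ b ∈ B, ((C \ B).filter (· < b)).card) •
      (laplaceSum (-(u : R)) (fun b a => X a b) B.sort S' *
        laplaceSum (-(u : R)) (fun b a => X a b) (C \ B).sort T') = 0 := by
    intro S' T'
    simp only [← laplaceSum_transpose (-(u : R)) h.antidiag]
    rw [← laplaceSum_append]
    by_cases hl : (S'.sort ++ T'.sort).Nodup
    · exact laplaceSum_eq_zero_of_length_ne _ _ (hl.length_le_card.trans_lt hC).ne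
    · exact h.laplaceSum_eq_zero_of_not_nodup hl C
  calc _ = ∑ S' ∈ S.powerset, ∑ T' ∈ T.powerset,
        ((-(u : R)) ^ (∑ b ∈ S', ((S \ S').filter (· < b)).card) •
          laplaceSum (-(u : R)) (fun b a => X a b) P S') *
        (∑ B ∈ C.powerset, (-(u : R)) ^ (∑ b ∈ B, ((C \ B).filter (· < b)).card) •
          (laplaceSum (-(u : R)) (fun b a => X a b) B.sort (S \ S') *
            laplaceSum (-(u : R)) (fun b a => X a b) (C \ B).sort T')) *
        ((-(u : R)) ^ (∑ b ∈ T', ((T \ T').filter (· < b)).card) •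
          laplaceSum (-(u : R)) (fun b a => X a b) Q (T \ T')) := by
        simp only [laplaceSum_append, Finset.mul_sum, Finset.sum_mul, Finset.smul_sum]
        rw [Finset.sum_comm]
        conv_rhs => rw [Finset.sum_comm]
        refine Finset.sum_congr rfl fun T' _ => ?_
        rw [Finset.sum_comm]
        refine Finset.sum_congr rfl fun S' _ => Finset.sum_congr rfl fun B _ => ?_
        simp only [smul_mul_assoc, mul_smul_comm, smul_smul, mul_assoc]
        congr 1
        ring
    _ = 0 := by simp only [key, mul_zero, zero_mul, Finset.sum_const_zero]

end IsQuantumMatrix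

section PermutationSum

/-- The permutation of `Fin (t + 1)` sending `0` to `p` and restricting to `τ` elsewhere. -/
noncomputable def consPerm {t : ℕ} (p : Fin (t + 1)) (τ : Equiv.Perm (Fin t)) :
    Equiv.Perm (Fin (t + 1)) :=
  Equiv.ofBijective (Fin.cons p (p.succAbove ∘ τ) : Fin (t + 1) → Fin (t + 1))
    (Finite.injective_iff_bijective.1 (Fin.cons_injective_iff.2
      ⟨by rintro ⟨i, hi⟩; exact Fin.succAbove_ne _ _ hi,
        Fin.succAbove_right_injective.comp τ.injective⟩))

theorem consPerm_zero {t : ℕ} (p : Fin (t + 1)) (τ : Equiv.Perm (Fin t)) :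
    consPerm p τ 0 = p := rfl

theorem consPerm_succ {t : ℕ} (p : Fin (t + 1)) (τ : Equiv.Perm (Fin t)) (i : Fin t) :
    consPerm p τ i.succ = p.succAbove (τ i) := rfl

theorem consPerm_bijective (t : ℕ) :
    Function.Bijective fun x : Fin (t + 1) × Equiv.Perm (Fin t) => consPerm x.1 x.2 := by
  rw [Fintype.bijective_iff_injective_and_card]
  refine ⟨?_, by simp [Fintype.card_perm, Nat.factorial_succ]⟩
  rintro ⟨p, τ⟩ ⟨p', τ'⟩ h
  obtain rfl : p = p' := by simpa [consPerm_zero] using congrArg (fun σ => σ 0) h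
  refine Prod.ext rfl (Equiv.ext fun i => ?_)
  exact Fin.succAbove_right_injective (by
    simpa only [consPerm_succ] using congrArg (fun σ => σ i.succ) h)

theorem permLength_consPerm {t : ℕ} (p : Fin (t + 1)) (τ : Equiv.Perm (Fin t)) :
    permLength (consPerm p τ) = p + permLength τ := by
  have hp : (Finset.univ.filter fun i : Fin t => p.succAbove (τ i) < p).card = p := by
    have h : (Finset.univ.filter fun i : Fin t => p.succAbove i < p).card =
        (Finset.univ.filter fun i : Fin t => p.succAbove (τ i) < p).card :=
      (Finset.card_equiv τ (by simp)).symm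
    rw [← h, ← Finset.card_map (Fin.succAboveEmb p)]
    have : (Finset.univ.filter fun i : Fin t => p.succAbove i < p).map
        (Fin.succAboveEmb p) = Finset.Iio p := by
      ext x
      simp only [Finset.mem_map, Finset.mem_filter, Finset.mem_univ, true_and, Finset.mem_Iio]
      constructor
      · rintro ⟨i, hi, rfl⟩
        exact hi
      · intro hx
        obtain ⟨i, rfl⟩ := Fin.exists_succAbove_eq hx.ne
        exact ⟨i, hx, rfl⟩
    rw [this, Fin.card_Iio]
  simp only [permLength, Finset.card_filter, Fintype.sum_prod_type] at hp ⊢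
  rw [Fin.sum_univ_succ]
  simp only [Fin.sum_univ_succ, consPerm_zero, consPerm_succ, Fin.succ_pos, lt_irrefl,
    Fin.not_lt_zero, Fin.succ_lt_succ_iff, Fin.succAbove_lt_succAbove_iff, true_and, false_and,
    if_false, zero_add, hp]

theorem sum_perm_eq_laplaceSum [LinearOrder β] (c : R) (X : α → β → A) {t : ℕ}
    (r : Fin t → α) (J : Fin t ↪o β) :
    ∑ σ : Equiv.Perm (Fin t),
        c ^ permLength σ • (List.ofFn fun i => X (r i) (J (σ i))).prod =
      laplaceSum c X (List.ofFn r) (Finset.univ.map J.toEmbedding) := by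
  induction t with
  | zero => simp [laplaceSum_nil, permLength]
  | succ t ih =>
    rw [List.ofFn_succ, laplaceSum_cons, Finset.sum_map,
      ← (consPerm_bijective t).sum_comp, Fintype.sum_prod_type]
    refine Finset.sum_congr rfl fun p _ => ?_
    have h₁ : (Finset.univ.map J.toEmbedding).erase (J.toEmbedding p) =
        Finset.univ.map ((Fin.succAboveOrderEmb p).trans J).toEmbedding := by
      rw [← Finset.map_erase]
      ext x
      simp only [Finset.mem_map, Finset.mem_erase, Finset.mem_univ, and_true, true_and]
      constructor
      · rintro ⟨y, hy, rfl⟩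
        obtain ⟨i, rfl⟩ := Fin.exists_succAbove_eq hy
        exact ⟨i, rfl⟩
      · rintro ⟨i, rfl⟩
        exact ⟨p.succAbove i, Fin.succAbove_ne _ _, rfl⟩
    have h₂ : ((Finset.univ.map J.toEmbedding).filter (· < J.toEmbedding p)).card = p := by
      rw [Finset.filter_map, Finset.card_map, ← Fin.card_Iio p]
      congr 1
      ext x
      simp
    rw [h₁, h₂, ← ih, Finset.mul_sum, Finset.smul_sum]
    refine Finset.sum_congr rfl fun τ _ => ?_
    rw [permLength_consPerm, List.ofFn_succ, List.prod_cons, mul_smul_comm, smul_smul, ← pow_add]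
    rfl

end PermutationSum
end

section Minors
variable {R : Type*} [CommRing R] (u : Rˣ) {m n : ℕ}

theorem isQuantumMatrix_qX : IsQuantumMatrix u (qX R u : Fin m → Fin n → _) where
  row {i j l} h := by
    simpa [qX] using RingQuot.mkAlgHom_rel R (qMatrixRel.row (u := u) i j l h)
  col {i k j} h := by
    simpa [qX] using RingQuot.mkAlgHom_rel R (qMatrixRel.col (u := u) i k j h)
  antidiag {i k j l} hik hjl := by
    simpa [qX] using RingQuot.mkAlgHom_rel R (qMatrixRel.antidiag (u := u) i k j l hik hjl)
  diag {i k j l} hik hjl := by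
    simpa only [qX, map_mul, map_add, map_smul] using
      RingQuot.mkAlgHom_rel R (qMatrixRel.diag (u := u) i k j l hik hjl)

/-- The quantum minor on an arbitrary list of columns, expanded column by column. -/
def qColumnMinor (l : List (Fin n)) : QuantumMat R u m n :=
  laplaceSum (-(u : R)) (fun b a => qX R u a b) l Finset.univ

theorem qMaximalMinor_eq_qColumnMinor (J : Fin m ↪o Fin n) :
    qMaximalMinor R u J = qColumnMinor u (Finset.univ.map J.toEmbedding).sort := by
  have h : (Finset.univ : Finset (Fin m)).sort = List.ofFn id := by
    rw [List.ofFn_id, Fin.sort_univ]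
  rw [qColumnMinor, ← laplaceSum_transpose _ (isQuantumMatrix_qX u).antidiag, h,
    ← sum_perm_eq_laplaceSum]
  rfl

theorem exists_qColumnMinor_eq_smul {l : List (Fin n)} {J : Fin m ↪o Fin n} (hl : l.Nodup)
    (hJ : l.toFinset = Finset.univ.map J.toEmbedding) :
    ∃ v : Rˣ, qColumnMinor u l = v • qMaximalMinor R u J := by
  have hp : l.Perm (Finset.univ.map J.toEmbedding).sort := by
    rw [← hJ]
    exact ((Finset.sort_perm_toList _ _).trans (List.toFinset_toList hl)).symm
  obtain ⟨v, hv⟩ := (isQuantumMatrix_qX (R := R) u).transpose.exists_laplaceSum_eq_smul_of_perm hp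
  exact ⟨v, by rw [qMaximalMinor_eq_qColumnMinor]; exact hv _⟩

theorem qColumnMinor_eq_zero_or (l : List (Fin n)) :
    (qColumnMinor u l : QuantumMat R u m n) = 0 ∨ l.Nodup ∧ ∃ J : Fin m ↪o Fin n,
      l.toFinset = Finset.univ.map J.toEmbedding ∧
      ∃ v : Rˣ, qColumnMinor u l = v • qMaximalMinor R u J := by
  by_cases hl : l.Nodup
  · by_cases hm : l.length = m
    · have hc : l.toFinset.card = m := by rw [List.toFinset_card_of_nodup hl, hm]
      have hJ : l.toFinset = Finset.univ.map (l.toFinset.orderEmbOfFin hc).toEmbedding :=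
        (Finset.map_orderEmbOfFin_univ _ hc).symm
      exact Or.inr ⟨hl, _, hJ, exists_qColumnMinor_eq_smul u hl hJ⟩
    · exact Or.inl (laplaceSum_eq_zero_of_length_ne _ _ (by simpa using hm))
  · exact Or.inl ((isQuantumMatrix_qX u).transpose.laplaceSum_eq_zero_of_not_nodup hl _)

/-- Replacing the top part `I k < I (k + 1) < ⋯` of an index set by elements that either belong
to it or are smaller than `I k` gives an index set below `I`. -/
theorem le_of_subset_union {I I' : Fin m ↪o Fin n} {k : Fin m} {B : Finset (Fin n)}
    (hI' : Finset.univ.map I'.toEmbedding = (Finset.Iio k).map I.toEmbedding ∪ B)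
    (hdisj : Disjoint ((Finset.Iio k).map I.toEmbedding) B)
    (hB : ∀ x ∈ B, x < I k ∨ x ∈ (Finset.Ici k).map I.toEmbedding) : I' ≤ I := by
  have hBcard : (k : ℕ) + B.card = m := by
    simpa [Finset.card_union_of_disjoint hdisj] using (congrArg Finset.card hI').symm
  intro s
  by_contra! hs
  have hs' : I s < I' s := hs
  have hsub : (Finset.Ici s).map I'.toEmbedding ⊆
      (Finset.univ.map I'.toEmbedding).filter (I s < ·) := by
    intro x hx
    obtain ⟨y, hy, rfl⟩ := Finset.mem_map.1 hx
    refine Finset.mem_filter.2 ⟨Finset.mem_map_of_mem _ (Finset.mem_univ _), ?_⟩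
    exact hs'.trans_le (I'.monotone (Finset.mem_Ici.1 hy))
  have hcard := Finset.card_le_card hsub
  rw [Finset.card_map, Fin.card_Ici, hI'] at hcard
  rcases lt_or_ge s k with hsk | hsk
  · have : ((Finset.Iio k).map I.toEmbedding ∪ B).filter (I s < ·) ⊆
        (Finset.Ioo s k).map I.toEmbedding ∪ B := by
      intro x hx
      simp only [Finset.mem_filter, Finset.mem_union, Finset.mem_map, Finset.mem_Iio,
        Finset.mem_Ioo] at hx ⊢
      rcases hx with ⟨⟨y, hy, rfl⟩ | hx, hlt⟩
      · exact Or.inl ⟨y, ⟨I.lt_iff_lt.1 hlt, hy⟩, rfl⟩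
      · exact Or.inr hx
    have h := hcard.trans ((Finset.card_le_card this).trans (Finset.card_union_le _ _))
    rw [Finset.card_map, Fin.card_Ioo] at h
    have := Fin.lt_def.1 hsk
    omega
  · have : ((Finset.Iio k).map I.toEmbedding ∪ B).filter (I s < ·) ⊆
        (Finset.Ioi s).map I.toEmbedding := by
      intro x hx
      simp only [Finset.mem_filter, Finset.mem_union] at hx
      obtain ⟨hx, hlt⟩ := hx
      obtain ⟨y, rfl⟩ : ∃ y, I y = x := by
        rcases hx with hx | hx
        · obtain ⟨y, -, rfl⟩ := Finset.mem_map.1 hx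
          exact ⟨y, rfl⟩
        · rcases hB x hx with hx | hx
          · exact absurd (hx.trans_le (I.monotone hsk)) hlt.not_gt
          · obtain ⟨y, -, rfl⟩ := Finset.mem_map.1 hx
            exact ⟨y, rfl⟩
      exact Finset.mem_map_of_mem _ (Finset.mem_Ioi.2 (I.lt_iff_lt.1 hlt))
    have h := hcard.trans (Finset.card_le_card this)
    rw [Finset.card_map, Fin.card_Ioi] at h
    have := s.isLt
    omega

/-- Straightening: a product of two maximal minors that is not standard is a combination of
products whose first factor is strictly smaller. -/
theorem qMaximalMinor_mul_mem_span {I J : Fin m ↪o Fin n} (h : ¬ I ≤ J) :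
    qMaximalMinor R u I * qMaximalMinor R u J ∈ Submodule.span R
      {x | ∃ I' J' : Fin m ↪o Fin n, I' < I ∧ x = qMaximalMinor R u I' * qMaximalMinor R u J'} := by
  obtain ⟨k, hk⟩ : ∃ k, J k < I k := by
    by_contra! hle
    exact h hle
  set P := (Finset.Iio k).map I.toEmbedding with hP
  set B₀ := (Finset.Ici k).map I.toEmbedding with hB₀
  set D₀ := (Finset.Iic k).map J.toEmbedding with hD₀
  set Q := (Finset.Ioi k).map J.toEmbedding with hQ
  have hD₀lt : ∀ x ∈ D₀, x < I k := by
    intro x hx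
    obtain ⟨y, hy, rfl⟩ := Finset.mem_map.1 hx
    exact (J.monotone (Finset.mem_Iic.1 hy)).trans_lt hk
  have hBD : Disjoint B₀ D₀ := by
    refine Finset.disjoint_left.2 fun x hx hx' => ?_
    obtain ⟨y, hy, rfl⟩ := Finset.mem_map.1 hx
    exact (hD₀lt _ hx').not_ge (I.monotone (Finset.mem_Ici.1 hy))
  have hPB : Disjoint P B₀ := by
    rw [hP, hB₀, Finset.disjoint_map]
    exact Finset.disjoint_left.2 fun x hx hx' =>
      (Finset.mem_Iio.1 hx).not_ge (Finset.mem_Ici.1 hx')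
  have hDQ : Disjoint D₀ Q := by
    rw [hD₀, hQ, Finset.disjoint_map]
    exact Finset.disjoint_left.2 fun x hx hx' =>
      (Finset.mem_Iic.1 hx).not_gt (Finset.mem_Ioi.1 hx')
  have hPBun : P ∪ B₀ = Finset.univ.map I.toEmbedding := by
    rw [hP, hB₀, ← Finset.map_union]
    congr 1
    ext x
    simpa using lt_or_ge x k
  have hDQun : D₀ ∪ Q = Finset.univ.map J.toEmbedding := by
    rw [hD₀, hQ, ← Finset.map_union]
    congr 1
    ext x
    simpa using le_or_gt x k
  have hcard : Fintype.card (Fin m) < (B₀ ∪ D₀).card := by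
    rw [Finset.card_union_of_disjoint hBD, hB₀, hD₀, Finset.card_map, Finset.card_map,
      Fin.card_Ici, Fin.card_Iic, Fintype.card_fin]
    have := k.isLt
    omega
  have hsd : (B₀ ∪ D₀) \ B₀ = D₀ := Finset.union_sdiff_cancel_left hBD
  have hrel := (isQuantumMatrix_qX (R := R) u).sum_laplaceSum_mul_laplaceSum_eq_zero
    Finset.univ Finset.univ P.sort Q.sort (B₀ ∪ D₀) hcard
  rw [← Finset.add_sum_erase _ _ (Finset.mem_powerset.2 Finset.subset_union_left), hsd] at hrel
  obtain ⟨v, hv⟩ := exists_qColumnMinor_eq_smul u (l := P.sort ++ B₀.sort) (J := I)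
    (List.nodup_append'.2 ⟨Finset.sort_nodup _ _, Finset.sort_nodup _ _, fun x hx hx' =>
      Finset.disjoint_left.1 hPB ((Finset.mem_sort _).1 hx) ((Finset.mem_sort _).1 hx')⟩)
    (by rw [List.toFinset_append, Finset.sort_toFinset, Finset.sort_toFinset, hPBun])
  obtain ⟨w, hw⟩ := exists_qColumnMinor_eq_smul u (l := D₀.sort ++ Q.sort) (J := J)
    (List.nodup_append'.2 ⟨Finset.sort_nodup _ _, Finset.sort_nodup _ _, fun x hx hx' =>
      Finset.disjoint_left.1 hDQ ((Finset.mem_sort _).1 hx) ((Finset.mem_sort _).1 hx')⟩)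
    (by rw [List.toFinset_append, Finset.sort_toFinset, Finset.sort_toFinset, hDQun])
  rw [← qColumnMinor, ← qColumnMinor, hv, hw, smul_mul_smul_comm] at hrel
  rw [← Submodule.smul_mem_iff' _ (v * w), ← Submodule.smul_mem_iff' _
    ((-u) ^ ∑ b ∈ B₀, (D₀.filter (· < b)).card)]
  rw [Units.smul_def ((-u) ^ _), Units.val_pow_eq_pow_val, Units.val_neg,
    eq_neg_of_add_eq_zero_left hrel]
  refine neg_mem (Submodule.sum_mem _ fun B hB => Submodule.smul_mem _ _ ?_)
  obtain ⟨hne, hsub⟩ := Finset.mem_erase.1 hB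
  rw [Finset.mem_powerset] at hsub
  rw [← qColumnMinor, ← qColumnMinor]
  rcases qColumnMinor_eq_zero_or u (m := m) (P.sort ++ B.sort) with h₀ | ⟨hnd, I', hI', v', hv'⟩
  · rw [h₀, zero_mul]
    exact zero_mem _
  rcases qColumnMinor_eq_zero_or u (m := m) (((B₀ ∪ D₀) \ B).sort ++ Q.sort) with
    h₀ | ⟨-, J', -, w', hw'⟩
  · rw [h₀, mul_zero]
    exact zero_mem _
  rw [hv', hw', smul_mul_smul_comm, Submodule.smul_mem_iff']
  rw [List.toFinset_append, Finset.sort_toFinset, Finset.sort_toFinset] at hI'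
  have hPB' : Disjoint P B := Finset.disjoint_left.2 fun x hx hx' =>
    (List.nodup_append'.1 hnd).2.2 ((Finset.mem_sort _).2 hx) ((Finset.mem_sort _).2 hx')
  refine Submodule.subset_span ⟨I', J', lt_of_le_of_ne
    (le_of_subset_union hI'.symm hPB' fun x hx => ?_) ?_, rfl⟩
  · exact (Finset.mem_union.1 (hsub hx)).symm.imp_left (hD₀lt x)
  · rintro rfl
    rw [← hPBun] at hI'
    apply hne
    rw [← Finset.union_sdiff_cancel_left hPB', hI', Finset.union_sdiff_cancel_left hPB]

end Minors

/-- Let `K` be a field, `q ∈ K` nonzero and `m ≤ n` positive integers.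
In `O_q(G_{m,n}(K))`, any product `[I₁][I₂]⋯[I_s]` of maximal quantum minors (`s ≥ 1`) is a
`K`-linear combination of standard monomials `[J₁]⋯[J_s]` (with `J₁ ≤st ⋯ ≤st J_s`) of the
same length satisfying `J₁ ≤st I₁`. -/
theorem quantumGrassmannian_rewrite_head (K : Type*) [Field K] (q : K) (hq : q ≠ 0)
    (m n : ℕ) (hm : 0 < m) (hmn : m ≤ n)
    (I₁ : Fin m ↪o Fin n) (rest : List (Fin m ↪o Fin n)) :
    ((I₁ :: rest).map (qMaximalMinor K (Units.mk0 q hq))).prod ∈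
      Submodule.span K
        {x : QuantumMat K (Units.mk0 q hq) m n |
          ∃ (J₁ : Fin m ↪o Fin n) (tl : List (Fin m ↪o Fin n)),
            (J₁ :: tl).Chain' (· ≤ ·) ∧ tl.length = rest.length ∧ J₁ ≤ I₁ ∧
            x = ((J₁ :: tl).map (qMaximalMinor K (Units.mk0 q hq))).prod} := by
  induction hs : rest.length generalizing I₁ rest with
  | zero =>
    obtain rfl := List.length_eq_zero_iff.1 hs
    exact Submodule.subset_span ⟨I₁, [], List.isChain_singleton _, rfl, le_rfl, rfl⟩
  | succ s ihs =>
    induction I₁ using WellFoundedLT.induction generalizing rest with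
    | _ I₁ ihI =>
    obtain ⟨I₂, rest, rfl⟩ := List.exists_cons_of_length_eq_add_one hs
    have hrest := Submodule.mem_map_of_mem (f := LinearMap.mulLeft K
      (qMaximalMinor K (Units.mk0 q hq) I₁)) (ihs I₂ rest (by simpa using hs))
    rw [Submodule.map_span] at hrest
    rw [List.map_cons, List.prod_cons]
    refine Submodule.span_le.2 ?_ hrest
    rintro _ ⟨_, ⟨J₁, tl, hchain, hlen, -, rfl⟩, rfl⟩
    by_cases hIJ : I₁ ≤ J₁
    · exact Submodule.subset_span ⟨I₁, J₁ :: tl, List.isChain_cons_cons.2 ⟨hIJ, hchain⟩,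
        by simp [hlen], le_rfl, rfl⟩
    have hmul := Submodule.mem_map_of_mem (f := LinearMap.mulRight K
      (tl.map (qMaximalMinor K (Units.mk0 q hq))).prod)
      (qMaximalMinor_mul_mem_span (Units.mk0 q hq) hIJ)
    rw [Submodule.map_span] at hmul
    rw [LinearMap.mulLeft_apply, List.map_cons, List.prod_cons, ← mul_assoc]
    refine Submodule.span_le.2 ?_ hmul
    rintro _ ⟨_, ⟨I', J', hlt, rfl⟩, rfl⟩
    rw [LinearMap.mulRight_apply, mul_assoc, SetLike.mem_coe]
    refine Submodule.span_mono ?_ (ihI I' hlt (J' :: tl) (by simp [hlen]))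
    rintro x ⟨J, tl', hc, hl, hle, rfl⟩
    exact ⟨J, tl', hc, hl, hle.trans hlt.le, rfl⟩
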